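/- There exists δ ∈ (0, 1/4), depending only on p (independent of 𝒵 and of the solution), with the following property: if the trigonometric polynomial k(θ,t) = Σ_{n∈𝒵} k̂(n,t)·e^{inθ} is strictly positive and satisfies ∫₀^{2π} e^{iθ}/k(θ,t) dθ = 0 for every t ∈ [0, τ*), and the initial data satisfy δ·ψ̂(0) ≥ q²·|ψ̂(q)| for every q ∈ 𝒵 with q ≠ 0, then δ·ψ̂(0) ≥ q²·|k̂(q,t)| for every q ∈ 𝒵 with q ≠ 0 and every t ∈ [0, τ*). -/

import Mathlib

open Real MeasureTheory Filter Set

/-- `H(p,q₁,q₂) = 1/p - (p-1) q₁ q₂ - q₁²` (as a complex number). -/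
noncomputable def Hcoef (p : ℕ) (q₁ q₂ : ℤ) : ℂ :=
  1 / (p : ℂ) - ((p : ℂ) - 1) * (q₁ : ℂ) * (q₂ : ℂ) - (q₁ : ℂ)^2

/-- The tuples `(q₁,…,q_{p+1})` (with `q_{p+2} := n - q₁ - ⋯ - q_{p+1}` determined) such that
the full `(p+2)`-tuple lies in `𝓐_n ∩ 𝒵^{p+2}`, i.e. all entries belong to `𝒵` and at least two
entries of the full tuple are nonzero. -/
def fullTuple (p : ℕ) (n : ℤ) (v : Fin (p + 1) → ℤ) : Fin (p + 1 + 1) → ℤ :=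
  Fin.snoc v (n - ∑ i, v i)

def goodTuples (p : ℕ) (Z : Finset ℤ) (n : ℤ) : Finset (Fin (p + 1) → ℤ) :=
  (Fintype.piFinset fun _ : Fin (p + 1) => Z).filter fun v =>
    (n - ∑ i, v i) ∈ Z ∧
    ∃ i j : Fin (p + 1 + 1), i ≠ j ∧ fullTuple p n v i ≠ 0 ∧ fullTuple p n v j ≠ 0

/-- The nonlinear term `Σ_{q ∈ 𝓐_n ∩ 𝒵^{p+2}} H(p,q₁,q₂) k̂(q₁,t) ⋯ k̂(q_{p+2},t)`. -/
noncomputable def gSum (p : ℕ) (Z : Finset ℤ) (kh : ℤ → ℝ → ℂ) (n : ℤ) (t : ℝ) : ℂ :=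
  ∑ v ∈ goodTuples p Z n,
    Hcoef p (v 0) (v 1) * (∏ i, kh (v i) t) * kh (n - ∑ i, v i) t

/-- `k̂ : 𝒵 × [0,τ*) → ℂ` is a solution of the Galerkin system
`d/dt k̂(0,t) = (1/p) k̂(0,t)^{p+2} + Σ_{q ∈ 𝓐₀ ∩ 𝒵^{p+2}} H(p,q₁,q₂) k̂(q₁,t)⋯k̂(q_{p+2},t)`,
`d/dt k̂(n,t) = ((p+2)/p - n²) k̂(0,t)^{p+1} k̂(n,t) + Σ_{q ∈ 𝓐_n ∩ 𝒵^{p+2}} H(p,q₁,q₂) k̂(q₁,t)⋯k̂(q_{p+2},t)`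
for `n ∈ 𝒵`, `n ≠ 0`, with initial data `k̂(n,0) = ψ̂(n)` and the reality symmetry
`k̂(-n,t) = conj k̂(n,t)`.  Here `τ* ∈ (0,∞]` is modelled as an extended real number. -/
def IsGalerkin (p : ℕ) (Z : Finset ℤ) (tstar : EReal)
    (kh : ℤ → ℝ → ℂ) (ψh : ℤ → ℂ) : Prop :=
  (∀ t : ℝ, 0 ≤ t → (t : EReal) < tstar →
    HasDerivAt (kh 0) ((1 / (p : ℂ)) * (kh 0 t)^(p + 2) + gSum p Z kh 0 t) t) ∧
  (∀ n ∈ Z, n ≠ 0 → ∀ t : ℝ, 0 ≤ t → (t : EReal) < tstar →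
    HasDerivAt (kh n)
      ((((p : ℂ) + 2) / (p : ℂ) - (n : ℂ)^2) * (kh 0 t)^(p + 1) * kh n t
        + gSum p Z kh n t) t) ∧
  (∀ n ∈ Z, kh n 0 = ψh n) ∧
  (∀ n ∈ Z, ∀ t : ℝ, 0 ≤ t → (t : EReal) < tstar →
    kh (-n) t = (starRingEnd ℂ) (kh n t))

/-- The trigonometric polynomial `k(θ,t) = Σ_{n ∈ 𝒵} k̂(n,t) e^{inθ}`. -/
noncomputable def kpoly (Z : Finset ℤ) (kh : ℤ → ℝ → ℂ) (t θ : ℝ) : ℂ :=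
  ∑ n ∈ Z, kh n t * Complex.exp (Complex.I * (n : ℂ) * (θ : ℂ))

/-- The seminorm `‖ψ‖₂ = max{sup_{n ∈ 𝒵} n²|Re ψ̂(n)|, sup_{n ∈ 𝒵} n²|Im ψ̂(n)|}`. -/
noncomputable def snZ (Z : Finset ℤ) (ψh : ℤ → ℂ) : ℝ :=
  max (⨆ n : Z, ((n : ℤ) : ℝ)^2 * |(ψh n).re|)
      (⨆ n : Z, ((n : ℤ) : ℝ)^2 * |(ψh n).im|)

/-- The weight `1` at `0` and `1/q²` at `q ≠ 0`. -/
noncomputable def sqWeight (q : ℤ) : ℝ := if q = 0 then 1 else 1 / (q : ℝ)^2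

lemma sqWeight_pos (q : ℤ) : 0 < sqWeight q := by
  unfold sqWeight
  split_ifs with h
  · exact one_pos
  · have : (q : ℝ) ≠ 0 := by exact_mod_cast h
    positivity

lemma sq_mul_sqWeight_le_one (q : ℤ) : (q : ℝ)^2 * sqWeight q ≤ 1 := by
  unfold sqWeight
  split_ifs with h
  · simp [h]
  · have : (q : ℝ) ≠ 0 := by exact_mod_cast h
    field_simp
    exact le_rfl

lemma exists_sum_sqWeight_le :
    ∃ S : ℝ, 1 ≤ S ∧ ∀ Z : Finset ℤ, ∑ q ∈ Z, sqWeight q ≤ S := by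
  have hs : Summable sqWeight := by
    have h1 : Summable fun q : ℤ => 1 / (q : ℝ)^2 :=
      Real.summable_one_div_int_pow.mpr one_lt_two
    have h2 : Summable fun q : ℤ => if q = 0 then (1 : ℝ) else 0 :=
      (hasSum_ite_eq (0 : ℤ) (1 : ℝ)).summable
    refine (h1.add h2).congr fun q => ?_
    by_cases h : q = 0 <;> simp [sqWeight, h]
  refine ⟨∑' q, sqWeight q, ?_, fun Z => hs.sum_le_tsum Z fun q _ => (sqWeight_pos q).le⟩
  have h := hs.sum_le_tsum {0} fun q _ => (sqWeight_pos q).le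
  simpa [sqWeight] using h

lemma norm_Hcoef_le {p : ℕ} (hp : 1 ≤ p) (a b : ℤ) :
    ‖Hcoef p a b‖ ≤ 1 + p * (a : ℝ)^2 + p * (b : ℝ)^2 := by
  have hp' : (1 : ℝ) ≤ p := by exact_mod_cast hp
  have h : Hcoef p a b =
      ((1 / (p : ℝ) - ((p : ℝ) - 1) * a * b - (a : ℝ)^2 : ℝ) : ℂ) := by
    simp [Hcoef]
  rw [h, Complex.norm_real, Real.norm_eq_abs, abs_le]
  have h1 : 1 / (p : ℝ) ≤ 1 := by
    rw [div_le_one (by linarith)]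
    exact hp'
  have h0 : 0 ≤ 1 / (p : ℝ) := by positivity
  constructor <;>
  nlinarith [mul_nonneg (sub_nonneg.2 hp') (sq_nonneg ((a : ℝ) - b)),
    mul_nonneg (sub_nonneg.2 hp') (sq_nonneg ((a : ℝ) + b)),
    mul_nonneg (sub_nonneg.2 hp') (sq_nonneg (a : ℝ)),
    mul_nonneg (sub_nonneg.2 hp') (sq_nonneg (b : ℝ)), sq_nonneg (a : ℝ), sq_nonneg (b : ℝ)]

/-- Exchanging the free entry `v j` with the determined entry `n - ∑ v` is injective. -/
lemma update_sub_sum_injective {m : ℕ} (n : ℤ) (j : Fin m) :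
    Function.Injective fun v : Fin m → ℤ => Function.update v j (n - ∑ i, v i) := by
  have hsum : ∀ (v : Fin m → ℤ) (x : ℤ),
      ∑ i, Function.update v j x i = x + (∑ i, v i - v j) := by
    intro v x
    rw [Finset.sum_update_of_mem (Finset.mem_univ j), Finset.sdiff_singleton_eq_erase,
      ← Finset.add_sum_erase _ _ (Finset.mem_univ j)]
    ring
  refine Function.LeftInverse.injective (g := fun v => Function.update v j (n - ∑ i, v i)) ?_
  intro v
  simp only [hsum, Function.update_idem]
  ext i
  by_cases h : i = j
  · subst h
    simp
  · simp [h]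

lemma sum_goodTuples_prod_le {p : ℕ} {Z : Finset ℤ} {S : ℝ}
    (hS : ∑ q ∈ Z, sqWeight q ≤ S) (n : ℤ) (f : (Fin (p + 1) → ℤ) → Fin (p + 1) → ℤ)
    (hf : Function.Injective f)
    (hfZ : ∀ v ∈ goodTuples p Z n, ∀ i, f v i ∈ Z) :
    ∑ v ∈ goodTuples p Z n, ∏ i, sqWeight (f v i) ≤ S ^ (p + 1) := by
  classical
  calc ∑ v ∈ goodTuples p Z n, ∏ i, sqWeight (f v i)
      = ∑ w ∈ (goodTuples p Z n).image f, ∏ i, sqWeight (w i) :=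
        (Finset.sum_image (f := fun w => ∏ i, sqWeight (w i)) fun _ _ _ _ h => hf h).symm
    _ ≤ ∑ w ∈ Fintype.piFinset fun _ : Fin (p + 1) => Z, ∏ i, sqWeight (w i) := by
        refine Finset.sum_le_sum_of_subset_of_nonneg ?_ fun w _ _ =>
          Finset.prod_nonneg fun i _ => (sqWeight_pos _).le
        intro w hw
        obtain ⟨v, hv, rfl⟩ := Finset.mem_image.1 hw
        exact Fintype.mem_piFinset.2 (hfZ v hv)
    _ = (∑ q ∈ Z, sqWeight q) ^ (p + 1) := by
        rw [← Finset.prod_univ_sum]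
        simp
    _ ≤ S ^ (p + 1) := by
        gcongr
        exact Finset.sum_nonneg fun q _ => (sqWeight_pos q).le

lemma sum_goodTuples_sqWeight_le {p : ℕ} {Z : Finset ℤ} {S : ℝ}
    (hS : ∑ q ∈ Z, sqWeight q ≤ S) (n : ℤ) :
    ∑ v ∈ goodTuples p Z n, (∏ i, sqWeight (v i)) * sqWeight (n - ∑ i, v i) ≤ S ^ (p + 1) := by
  refine le_trans (Finset.sum_le_sum fun v _ => ?_)
    (sum_goodTuples_prod_le hS n id Function.injective_id fun v hv i => ?_)
  · refine mul_le_of_le_one_right (Finset.prod_nonneg fun i _ => (sqWeight_pos _).le) ?_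
    by_cases h : n - ∑ i, v i = 0
    · simp [sqWeight, h]
    · refine le_trans ?_ (sq_mul_sqWeight_le_one (n - ∑ i, v i))
      refine le_mul_of_one_le_left (sqWeight_pos _).le ?_
      have : 1 ≤ (n - ∑ i, v i)^2 := by
        have := sq_pos_of_ne_zero h
        omega
      exact_mod_cast this
  · exact Fintype.mem_piFinset.1 (Finset.mem_filter.1 hv).1 i

lemma sum_goodTuples_sq_mul_sqWeight_le {p : ℕ} {Z : Finset ℤ} {S : ℝ}
    (hS : ∑ q ∈ Z, sqWeight q ≤ S) (n : ℤ) (j : Fin (p + 1)) :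
    ∑ v ∈ goodTuples p Z n,
      (v j : ℝ)^2 * ((∏ i, sqWeight (v i)) * sqWeight (n - ∑ i, v i)) ≤ S ^ (p + 1) := by
  refine le_trans (Finset.sum_le_sum fun v _ => ?_)
    (sum_goodTuples_prod_le hS n _ (update_sub_sum_injective n j) fun v hv i => ?_)
  · have h1 : ∏ i, sqWeight (Function.update v j (n - ∑ i, v i) i) =
        sqWeight (n - ∑ i, v i) * ∏ i ∈ Finset.univ.erase j, sqWeight (v i) := by
      rw [← Finset.mul_prod_erase _ _ (Finset.mem_univ j), Function.update_self]
      congr 1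
      refine Finset.prod_congr rfl fun i hi => ?_
      rw [Function.update_of_ne (Finset.ne_of_mem_erase hi)]
    rw [h1, ← Finset.mul_prod_erase _ _ (Finset.mem_univ j)]
    have h2 : 0 ≤ sqWeight (n - ∑ i, v i) * ∏ i ∈ Finset.univ.erase j, sqWeight (v i) :=
      mul_nonneg (sqWeight_pos _).le (Finset.prod_nonneg fun i _ => (sqWeight_pos _).le)
    calc _ = ((v j : ℝ)^2 * sqWeight (v j)) *
          (sqWeight (n - ∑ i, v i) * ∏ i ∈ Finset.univ.erase j, sqWeight (v i)) := by ring
      _ ≤ _ := mul_le_of_le_one_left h2 (sq_mul_sqWeight_le_one _)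
  · have hv' := Finset.mem_filter.1 hv
    by_cases h : i = j
    · subst h
      simpa using hv'.2.1
    · simpa [h] using Fintype.mem_piFinset.1 hv'.1 i

/-- A product of terms with at least two factors at nonzero frequencies is quadratically small. -/
lemma prod_le_of_two_ne_zero {ι : Type*} [Fintype ι] [DecidableEq ι] {c : ℤ → ℝ} {K M δ : ℝ}
    (hc : ∀ q, 0 ≤ c q) (hK : 0 < K) (hδ1 : δ ≤ 1) (hMK : M ≤ δ * K)
    (u : ι → ℤ)
    (h0 : c 0 ≤ K) (h : ∀ k, u k ≠ 0 → c (u k) ≤ M * sqWeight (u k))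
    {i j : ι} (hij : i ≠ j) (hi : u i ≠ 0) (hj : u j ≠ 0) :
    ∏ k, c (u k) ≤ K ^ Fintype.card ι * (M / K) * δ * ∏ k, sqWeight (u k) := by
  have hB : ∏ k : ι, (K * (if k = i then M / K else 1) * (if k = j then δ else 1)) =
      K ^ Fintype.card ι * (M / K) * δ := by
    rw [Finset.prod_mul_distrib, Finset.prod_mul_distrib]
    simp
  rw [← hB, ← Finset.prod_mul_distrib]
  refine Finset.prod_le_prod (fun k _ => hc _) fun k _ => ?_
  have hβ := (sqWeight_pos (u k)).le
  by_cases hki : k = i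
  · subst hki
    have : K * (M / K) = M := by field_simp
    simpa [hij, this] using h k hi
  by_cases hkj : k = j
  · subst hkj
    simp only [hki, if_true, if_false, mul_one]
    refine (h k hj).trans ?_
    rw [mul_comm K]
    gcongr
  simp only [hki, hkj, if_false, mul_one]
  by_cases hk : u k = 0
  · simpa [hk, sqWeight] using h0
  · refine (h k hk).trans ?_
    gcongr
    nlinarith

lemma norm_gSum_le {p : ℕ} (hp : 1 ≤ p) {Z : Finset ℤ} {S : ℝ}
    (hS : ∑ q ∈ Z, sqWeight q ≤ S) {kh : ℤ → ℝ → ℂ} {t K M δ : ℝ}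
    (hK : 0 < K) (hM : 0 ≤ M) (hδ0 : 0 ≤ δ) (hδ1 : δ ≤ 1) (hMK : M ≤ δ * K)
    (h0 : ‖kh 0 t‖ ≤ K) (h : ∀ q ∈ Z, q ≠ 0 → ‖kh q t‖ ≤ M * sqWeight q) (n : ℤ) :
    ‖gSum p Z kh n t‖ ≤ (1 + 2 * p) * S ^ (p + 1) * δ * M * K ^ (p + 1) := by
  have hterm : ∀ v ∈ goodTuples p Z n,
      ‖Hcoef p (v 0) (v 1) * (∏ i, kh (v i) t) * kh (n - ∑ i, v i) t‖ ≤
      (δ * M * K ^ (p + 1)) * (((∏ i, sqWeight (v i)) * sqWeight (n - ∑ i, v i)) +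
        p * ((v 0 : ℝ)^2 * ((∏ i, sqWeight (v i)) * sqWeight (n - ∑ i, v i))) +
        p * ((v 1 : ℝ)^2 * ((∏ i, sqWeight (v i)) * sqWeight (n - ∑ i, v i)))) := by
    intro v hv
    obtain ⟨hvZ, hl, i, j, hij, hi, hj⟩ := Finset.mem_filter.1 hv
    rw [Fintype.mem_piFinset] at hvZ
    have hmem : ∀ k, fullTuple p n v k ∈ Z := by
      intro k
      refine Fin.lastCases ?_ (fun k => ?_) k
      · simpa [fullTuple] using hl
      · simpa [fullTuple] using hvZ k
    have hprod := prod_le_of_two_ne_zero (c := fun q => ‖kh q t‖) (fun q => norm_nonneg _)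
      hK hδ1 hMK (fullTuple p n v) h0 (fun k hk => h _ (hmem k) hk) hij hi hj
    rw [Fin.prod_univ_castSucc, Fin.prod_univ_castSucc (f := fun k => sqWeight _)] at hprod
    simp only [fullTuple, Fin.snoc_castSucc, Fin.snoc_last, Fintype.card_fin] at hprod
    have hconst : K ^ (p + 1 + 1) * (M / K) * δ = δ * M * K ^ (p + 1) := by
      field_simp
      ring
    rw [hconst] at hprod
    rw [mul_assoc, norm_mul, norm_mul, norm_prod]
    calc _ ≤ (1 + p * (v 0 : ℝ)^2 + p * (v 1 : ℝ)^2) * (δ * M * K ^ (p + 1) *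
          ((∏ i, sqWeight (v i)) * sqWeight (n - ∑ i, v i))) := by
          gcongr
          exact norm_Hcoef_le hp _ _
      _ = _ := by ring
  refine (norm_sum_le _ _).trans ((Finset.sum_le_sum hterm).trans ?_)
  rw [← Finset.mul_sum, Finset.sum_add_distrib, Finset.sum_add_distrib, ← Finset.mul_sum,
    ← Finset.mul_sum]
  have h1 := sum_goodTuples_sqWeight_le (p := p) hS n
  have h2 := sum_goodTuples_sq_mul_sqWeight_le (p := p) hS n 0
  have h3 := sum_goodTuples_sq_mul_sqWeight_le (p := p) hS n 1
  calc _ ≤ (δ * M * K ^ (p + 1)) * (S ^ (p + 1) + p * S ^ (p + 1) + p * S ^ (p + 1)) := by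
        gcongr
    _ = _ := by ring

lemma integral_exp_int_mul (m : ℤ) :
    (∫ θ in (0:ℝ)..(2 * Real.pi), Complex.exp (Complex.I * (m : ℂ) * (θ : ℂ))) =
      if m = 0 then 2 * (Real.pi : ℂ) else 0 := by
  split_ifs with h
  · simp [h]
  · have hc : Complex.I * (m : ℂ) ≠ 0 :=
      mul_ne_zero Complex.I_ne_zero (by exact_mod_cast h)
    rw [integral_exp_mul_complex hc]
    have : Complex.I * (m : ℂ) * ((2 * Real.pi : ℝ) : ℂ) = m * (2 * Real.pi * Complex.I) := by
      push_cast
      ring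
    rw [this, Complex.exp_int_mul_two_pi_mul_I]
    simp

lemma continuous_kpoly (Z : Finset ℤ) (kh : ℤ → ℝ → ℂ) (t : ℝ) : Continuous (kpoly Z kh t) := by
  unfold kpoly
  fun_prop

lemma integral_exp_mul_kpoly {Z : Finset ℤ} (hZ : (-1 : ℤ) ∈ Z) (kh : ℤ → ℝ → ℂ) (t : ℝ) :
    (∫ θ in (0:ℝ)..(2 * Real.pi), Complex.exp (Complex.I * (θ : ℂ)) * kpoly Z kh t θ) =
      2 * (Real.pi : ℂ) * kh (-1) t := by
  have h : ∀ θ : ℝ, Complex.exp (Complex.I * (θ : ℂ)) * kpoly Z kh t θ =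
      ∑ n ∈ Z, kh n t * Complex.exp (Complex.I * ((n + 1 : ℤ) : ℂ) * (θ : ℂ)) := by
    intro θ
    rw [kpoly, Finset.mul_sum]
    refine Finset.sum_congr rfl fun n _ => ?_
    rw [mul_left_comm, ← Complex.exp_add]
    congr 2
    push_cast
    ring
  simp_rw [h]
  rw [intervalIntegral.integral_finsetSum fun n _ =>
    Continuous.intervalIntegrable (by fun_prop) _ _]
  simp_rw [intervalIntegral.integral_const_mul, integral_exp_int_mul]
  rw [Finset.sum_eq_single (-1)]
  · simp [mul_comm]
  · intro n _ hn
    have : n + 1 ≠ 0 := by omega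
    simp [this]
  · exact fun h => absurd hZ h

lemma norm_kpoly_sub_le {Z : Finset ℤ} (hZ0 : (0 : ℤ) ∈ Z) {S : ℝ}
    (hS : ∑ q ∈ Z, sqWeight q ≤ S) {kh : ℤ → ℝ → ℂ} {t M : ℝ} (hM : 0 ≤ M)
    (h : ∀ q ∈ Z, q ≠ 0 → ‖kh q t‖ ≤ M * sqWeight q) (θ : ℝ) :
    ‖kpoly Z kh t θ - kh 0 t‖ ≤ M * S := by
  have h1 : kpoly Z kh t θ - kh 0 t =
      ∑ n ∈ Z.erase 0, kh n t * Complex.exp (Complex.I * (n : ℂ) * (θ : ℂ)) := by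
    rw [kpoly, ← Finset.add_sum_erase _ _ hZ0]
    simp
  rw [h1]
  calc _ ≤ ∑ n ∈ Z.erase 0, M * sqWeight n := by
        refine norm_sum_le_of_le _ fun n hn => ?_
        have he : Complex.I * (n : ℂ) * (θ : ℂ) = ((n * θ : ℝ) : ℂ) * Complex.I := by
          push_cast
          ring
        rw [norm_mul, he, Complex.norm_exp_ofReal_mul_I, mul_one]
        exact h n (Finset.mem_of_mem_erase hn) (Finset.ne_of_mem_erase hn)
    _ ≤ ∑ n ∈ Z, M * sqWeight n :=
        Finset.sum_le_sum_of_subset_of_nonneg (Finset.erase_subset _ _) fun n _ _ =>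
          mul_nonneg hM (sqWeight_pos n).le
    _ ≤ M * S := by
        rw [← Finset.mul_sum]
        gcongr

/-- The closing condition `∫ e^{iθ}/k dθ = 0` makes the first mode quadratically small. -/
lemma norm_kh_neg_one_le {Z : Finset ℤ} (hZ : (-1 : ℤ) ∈ Z)
    {kh : ℤ → ℝ → ℂ} {t W : ℝ} (hW : ∀ θ : ℝ, ‖kpoly Z kh t θ - kh 0 t‖ ≤ W)
    (hWK : W < ‖kh 0 t‖)
    (hclose : (∫ θ in (0:ℝ)..(2 * Real.pi),
      Complex.exp (Complex.I * (θ : ℂ)) / kpoly Z kh t θ) = 0) :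
    ‖kh (-1) t‖ ≤ W ^ 2 / (‖kh 0 t‖ - W) := by
  have hk : ∀ θ, ‖kh 0 t‖ - W ≤ ‖kpoly Z kh t θ‖ := by
    intro θ
    have h1 := norm_sub_norm_le (kh 0 t) (kh 0 t - kpoly Z kh t θ)
    rw [sub_sub_cancel, norm_sub_rev] at h1
    linarith [hW θ]
  have hk0 : ∀ θ, kpoly Z kh t θ ≠ 0 := fun θ =>
    norm_pos_iff.1 (lt_of_lt_of_le (by linarith) (hk θ))
  have hcont := continuous_kpoly Z kh t
  have hexp : Continuous fun θ : ℝ => Complex.exp (Complex.I * (θ : ℂ)) := by fun_prop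
  have hid : ∀ θ : ℝ, Complex.exp (Complex.I * (θ : ℂ)) *
      ((kpoly Z kh t θ - kh 0 t) ^ 2 / kpoly Z kh t θ) =
      (kh 0 t) ^ 2 * (Complex.exp (Complex.I * (θ : ℂ)) / kpoly Z kh t θ) -
        2 * kh 0 t * Complex.exp (Complex.I * (θ : ℂ)) +
        Complex.exp (Complex.I * (θ : ℂ)) * kpoly Z kh t θ := by
    intro θ
    field_simp [hk0 θ]
    ring
  have hexp0 : (∫ θ in (0:ℝ)..(2 * Real.pi), Complex.exp (Complex.I * (θ : ℂ))) = 0 := by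
    simpa using integral_exp_int_mul 1
  have hI : (∫ θ in (0:ℝ)..(2 * Real.pi), Complex.exp (Complex.I * (θ : ℂ)) *
      ((kpoly Z kh t θ - kh 0 t) ^ 2 / kpoly Z kh t θ)) = 2 * (Real.pi : ℂ) * kh (-1) t := by
    have i1 : IntervalIntegrable (fun θ : ℝ => (kh 0 t) ^ 2 *
        (Complex.exp (Complex.I * (θ : ℂ)) / kpoly Z kh t θ)) volume 0 (2 * Real.pi) :=
      (continuous_const.mul (hexp.div hcont hk0)).intervalIntegrable _ _
    have i2 : IntervalIntegrable (fun θ : ℝ => 2 * kh 0 t *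
        Complex.exp (Complex.I * (θ : ℂ))) volume 0 (2 * Real.pi) :=
      (continuous_const.mul hexp).intervalIntegrable _ _
    have i3 : IntervalIntegrable (fun θ : ℝ => Complex.exp (Complex.I * (θ : ℂ)) *
        kpoly Z kh t θ) volume 0 (2 * Real.pi) :=
      (hexp.mul hcont).intervalIntegrable _ _
    simp_rw [hid]
    rw [intervalIntegral.integral_add (i1.sub i2) i3, intervalIntegral.integral_sub i1 i2,
      intervalIntegral.integral_const_mul, intervalIntegral.integral_const_mul, hclose, hexp0,
      integral_exp_mul_kpoly hZ]
    ring
  have hbound := intervalIntegral.norm_integral_le_of_norm_le_const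
    (a := 0) (b := 2 * Real.pi) (C := W ^ 2 / (‖kh 0 t‖ - W))
    (f := fun θ : ℝ => Complex.exp (Complex.I * (θ : ℂ)) *
      ((kpoly Z kh t θ - kh 0 t) ^ 2 / kpoly Z kh t θ)) fun θ _ => by
    have hpos : 0 < ‖kh 0 t‖ - W := by linarith
    rw [norm_mul, mul_comm Complex.I, Complex.norm_exp_ofReal_mul_I, one_mul, norm_div, norm_pow]
    gcongr
    · exact hW θ
    · exact hk θ
  have hpi := Real.pi_pos
  rw [hI, norm_mul, sub_zero, abs_of_pos (by positivity)] at hbound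
  have : ‖2 * (Real.pi : ℂ)‖ = 2 * Real.pi := by
    simp [abs_of_pos hpi]
  rw [this, mul_comm] at hbound
  exact le_of_mul_le_mul_right hbound (by positivity)

/-- Forward invariance of a region `{f i ≤ 0}` whose boundary is crossed strictly inwards. -/
lemma forall_nonpos_of_deriv_neg {ι : Type*} (s : Finset ι) (f f' : ι → ℝ → ℝ) (T : ℝ)
    (hd : ∀ i ∈ s, ∀ t ∈ Icc 0 T, HasDerivAt (f i) (f' i t) t)
    (h0 : ∀ i ∈ s, f i 0 ≤ 0)
    (hb : ∀ t ∈ Icc 0 T, (∀ i ∈ s, f i t ≤ 0) → ∀ i ∈ s, f i t = 0 → f' i t < 0) :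
    ∀ t ∈ Icc 0 T, ∀ i ∈ s, f i t ≤ 0 := by
  have hclosed : IsClosed ({t | ∀ i ∈ s, f i t ≤ 0} ∩ Icc 0 T) := by
    have : {t | ∀ i ∈ s, f i t ≤ 0} ∩ Icc 0 T =
        Icc 0 T ∩ ⋂ i ∈ s, (Icc 0 T ∩ f i ⁻¹' Iic 0) := by
      ext t
      simp only [mem_inter_iff, mem_ofPred_eq, mem_iInter, mem_preimage, mem_Iic]
      exact ⟨fun h => ⟨h.2, fun i hi => ⟨h.2, h.1 i hi⟩⟩, fun h => ⟨fun i hi => (h.2 i hi).2, h.1⟩⟩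
    rw [this]
    refine isClosed_Icc.inter (isClosed_biInter fun i hi => ?_)
    exact ContinuousOn.preimage_isClosed_of_isClosed
      (fun t ht => (hd i hi t ht).continuousAt.continuousWithinAt) isClosed_Icc isClosed_Iic
  refine hclosed.Icc_subset_of_forall_mem_nhdsWithin h0 ?_
  rintro t ⟨ht, htI⟩
  have htI' : t ∈ Icc 0 T := Ico_subset_Icc_self htI
  have : ∀ i ∈ s, ∀ᶠ x in nhdsWithin t (Ioi t), f i x ≤ 0 := by
    intro i hi
    have hdi := hd i hi t htI'
    rcases (ht i hi).lt_or_eq with hlt | heq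
    · filter_upwards [nhdsWithin_le_nhds (hdi.continuousAt.eventually_lt continuousAt_const hlt)]
        with x hx using hx.le
    · have hneg := hb t htI' ht i hi heq
      have hslope := (hasDerivWithinAt_iff_tendsto_slope' (by simp)).1
        (hdi.hasDerivWithinAt (s := Ioi t))
      filter_upwards [hslope.eventually_lt_const hneg, self_mem_nhdsWithin] with x hx hxt
      rw [slope_def_field, heq, sub_zero, div_lt_iff₀ (sub_pos.2 hxt), zero_mul] at hx
      exact hx.le
  exact (Filter.eventually_all_finset s).2 this

lemma neg_re_zero_mode_deriv_neg {p : ℕ} (hp : 1 ≤ p) {z g : ℂ} {K M δ : ℝ} (hz : z = (K : ℂ))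
    (hK : 0 < K) (hMK : M ≤ δ * K) (hδp : δ * p ≤ 1 / 100)
    (hg : ‖g‖ ≤ 1 / 100 * M * K ^ (p + 1)) :
    -((1 / (p : ℂ)) * z ^ (p + 2) + g).re < 0 := by
  have hp0 : (0 : ℝ) < p := by exact_mod_cast hp
  have h1 : (1 / (p : ℂ)) * z ^ (p + 2) = ((1 / (p : ℝ) * K ^ (p + 2) : ℝ) : ℂ) := by
    rw [hz]
    push_cast
    ring
  rw [h1, Complex.add_re, Complex.ofReal_re]
  have h2 := (abs_le.1 (Complex.abs_re_le_norm g)).1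
  have h3 : 1 / 100 * M * K ^ (p + 1) ≤ 1 / 100 * (δ * K) * K ^ (p + 1) := by gcongr
  have h4 : 1 / 100 * (δ * K) * K ^ (p + 1) = (1 / 100 * δ) * K ^ (p + 2) := by ring
  have h5 : 1 / 100 * δ < 1 / (p : ℝ) := by
    rw [lt_div_iff₀ hp0]
    linarith
  have h6 := mul_lt_mul_of_pos_right h5 (pow_pos hK (p + 2))
  linarith

lemma inner_high_mode_deriv_neg {p : ℕ} (hp : 1 ≤ p) {n : ℤ} (hn : 2 ≤ |n|) {z x g : ℂ}
    {K M : ℝ} (hz : z = (K : ℂ)) (hK : 0 < K) (hM : 0 < M) (hx : ‖x‖ = M * sqWeight n)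
    (hg : ‖g‖ ≤ 1 / 100 * M * K ^ (p + 1)) :
    2 * inner ℝ x ((((p : ℂ) + 2) / (p : ℂ) - (n : ℂ)^2) * z ^ (p + 1) * x + g) < 0 := by
  have hp1 : (1 : ℝ) ≤ p := by exact_mod_cast hp
  have hn0 : n ≠ 0 := by
    rintro rfl
    simp at hn
  have hn4 : (4 : ℝ) ≤ (n : ℝ)^2 := by
    rw [← sq_abs]
    have : (2 : ℝ) ≤ |(n : ℝ)| := by exact_mod_cast hn
    nlinarith
  have hw : (n : ℝ)^2 * sqWeight n = 1 := by
    have : (n : ℝ) ≠ 0 := by exact_mod_cast hn0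
    simp only [sqWeight, hn0, if_false]
    field_simp
  have hw0 := sqWeight_pos n
  set c : ℝ := ((p : ℝ) + 2) / p - (n : ℝ)^2 with hc
  have hc3 : c ≤ 3 - (n : ℝ)^2 := by
    have : ((p : ℝ) + 2) / p ≤ 3 := by
      rw [div_le_iff₀ (by linarith)]
      linarith
    linarith
  have h1 : (((p : ℂ) + 2) / (p : ℂ) - (n : ℂ)^2) * z ^ (p + 1) * x = (c * K ^ (p + 1)) • x := by
    rw [hz, Complex.real_smul, hc]
    push_cast
    ring
  rw [h1, inner_add_right, real_inner_smul_right, real_inner_self_eq_norm_sq]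
  have hxg : inner ℝ x g ≤ ‖x‖ * (1 / 100 * M * K ^ (p + 1)) :=
    (real_inner_le_norm x g).trans (by gcongr)
  have hx0 : 0 < ‖x‖ := by
    rw [hx]
    positivity
  have hneg : c * ‖x‖ + 1 / 100 * M < 0 := by
    have h2 : c * sqWeight n ≤ (3 - (n : ℝ)^2) * sqWeight n := by gcongr
    have h3 : c * sqWeight n + 1 / 100 < 0 := by nlinarith
    rw [hx]
    nlinarith
  have := mul_neg_of_pos_of_neg (mul_pos (pow_pos hK (p + 1)) hx0) hneg
  nlinarith

/-- There is `δ ∈ (0,1/4)` depending only on `p` such that: if the trigonometric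
polynomial `k(θ,t) = Σ_{n ∈ 𝒵} k̂(n,t) e^{inθ}` is strictly positive with
`∫₀^{2π} e^{iθ}/k(θ,t) dθ = 0` for every `t ∈ [0,τ*)`, and `δ ψ̂(0) ≥ q² |ψ̂(q)|` for every
nonzero `q ∈ 𝒵`, then `δ ψ̂(0) ≥ q² |k̂(q,t)|` for every nonzero `q ∈ 𝒵` and every
`t ∈ [0,τ*)`. -/
theorem statement5 (p : ℕ) (hp : 1 ≤ p) :
    ∃ δ : ℝ, δ ∈ Set.Ioo (0:ℝ) (1/4) ∧
      ∀ (Z : Finset ℤ), (0:ℤ) ∈ Z → (∀ n ∈ Z, -n ∈ Z) →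
      ∀ (tstar : EReal), 0 < tstar →
      ∀ (kh : ℤ → ℝ → ℂ) (ψh : ℤ → ℂ), IsGalerkin p Z tstar kh ψh →
      0 < (ψh 0).re →
      (∀ t : ℝ, 0 ≤ t → (t : EReal) < tstar → ∀ θ : ℝ, 0 < (kpoly Z kh t θ).re) →
      (∀ t : ℝ, 0 ≤ t → (t : EReal) < tstar →
        (∫ θ in (0:ℝ)..(2 * Real.pi),
          Complex.exp (Complex.I * (θ : ℂ)) / kpoly Z kh t θ) = 0) →
      (∀ q ∈ Z, q ≠ 0 → (q : ℝ)^2 * ‖ψh q‖ ≤ δ * (ψh 0).re) →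
      ∀ t : ℝ, 0 ≤ t → (t : EReal) < tstar →
        ∀ q ∈ Z, q ≠ 0 → (q : ℝ)^2 * ‖kh q t‖ ≤ δ * (ψh 0).re := by
  obtain ⟨S, hS1, hS⟩ := exists_sum_sqWeight_le
  have hp1 : (1 : ℝ) ≤ p := by exact_mod_cast hp
  obtain ⟨C, hCdef⟩ : ∃ C : ℝ, C = (1 + 2 * p) * S ^ (p + 1) := ⟨_, rfl⟩
  have hS2 : S ^ 2 ≤ S ^ (p + 1) := pow_le_pow_right₀ hS1 (by omega)
  have hSS : S ≤ S ^ 2 := by nlinarith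
  have hCS : S ^ 2 ≤ C := by nlinarith
  have hCp : (p : ℝ) ≤ C := by nlinarith
  have hC1 : 1 ≤ C := by linarith
  obtain ⟨δ, hδdef⟩ : ∃ δ : ℝ, δ = 1 / (100 * C) := ⟨_, rfl⟩
  have hδ0 : 0 < δ := by
    rw [hδdef]
    positivity
  have hCδ : C * δ = 1 / 100 := by
    rw [hδdef]
    field_simp
  have hδS : δ * S ^ 2 ≤ 1 / 100 := by nlinarith
  have hδp : δ * p ≤ 1 / 100 := by nlinarith
  have hδ1 : δ ≤ 1 / 100 := by nlinarith
  refine ⟨δ, ⟨hδ0, by linarith⟩, ?_⟩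
  intro Z hZ0 hZneg tstar htstar kh ψh ⟨hode0, hode, hinit, hsymm⟩ hψ0 _ hclose hψ T hT0 hT
  obtain ⟨M, hMdef⟩ : ∃ M : ℝ, M = δ * (ψh 0).re := ⟨_, rfl⟩
  have hM : 0 < M := by
    rw [hMdef]
    positivity
  have hadm : ∀ t ∈ Icc 0 T, 0 ≤ t ∧ (t : EReal) < tstar := fun t ht =>
    ⟨ht.1, lt_of_le_of_lt (EReal.coe_le_coe_iff.2 ht.2) hT⟩
  have hweight : ∀ q : ℤ, q ≠ 0 → ∀ x : ℝ, (q : ℝ)^2 * x ≤ M ↔ x ≤ M * sqWeight q := by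
    intro q hq x
    have : (q : ℝ) ≠ 0 := by exact_mod_cast hq
    have hq2 : 0 < (q : ℝ)^2 := by positivity
    simp only [sqWeight, hq, if_false]
    rw [mul_one_div, le_div_iff₀ hq2, mul_comm]
  have hsq : ∀ (q : ℤ) (t : ℝ),
      ‖kh q t‖ ^ 2 - (M * sqWeight q) ^ 2 ≤ 0 ↔ ‖kh q t‖ ≤ M * sqWeight q := by
    intro q t
    rw [sub_nonpos]
    exact sq_le_sq₀ (norm_nonneg _) (mul_pos hM (sqWeight_pos q)).le
  let f : ℤ → ℝ → ℝ := fun q t =>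
    if q = 0 then (ψh 0).re - (kh 0 t).re else ‖kh q t‖ ^ 2 - (M * sqWeight q) ^ 2
  let f' : ℤ → ℝ → ℝ := fun q t =>
    if q = 0 then -((1 / (p : ℂ)) * (kh 0 t)^(p + 2) + gSum p Z kh 0 t).re
    else 2 * inner ℝ (kh q t) ((((p : ℂ) + 2) / (p : ℂ) - (q : ℂ)^2) * (kh 0 t)^(p + 1) * kh q t
        + gSum p Z kh q t)
  have key : ∀ t ∈ Icc 0 T, ∀ q ∈ Z, f q t ≤ 0 := by
    refine forall_nonpos_of_deriv_neg Z f f' T ?_ ?_ ?_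
    · intro q hq t ht
      obtain ⟨ht0, htT⟩ := hadm t ht
      by_cases h : q = 0
      · simp only [f, f', h, if_true]
        exact (Complex.reCLM.hasFDerivAt.comp_hasDerivAt t (hode0 t ht0 htT)).const_sub _
      · simp only [f, f', h, if_false]
        exact (hode q hq h t ht0 htT).norm_sq.sub_const _
    · intro q hq
      by_cases h : q = 0
      · simp [f, h, hinit 0 hZ0]
      · simp only [f, h, if_false]
        rw [hsq, ← hweight q h, hinit q hq, hMdef]
        exact hψ q hq h
    · intro t ht hall
      obtain ⟨ht0, htT⟩ := hadm t ht
      have hre : (ψh 0).re ≤ (kh 0 t).re := by simpa [f] using hall 0 hZ0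
      have hmodes : ∀ q ∈ Z, q ≠ 0 → ‖kh q t‖ ≤ M * sqWeight q := by
        intro q hq h
        rw [← hsq]
        simpa only [f, h, if_false] using hall q hq
      obtain ⟨K, hK⟩ : ∃ K : ℝ, kh 0 t = (K : ℂ) := by
        have := hsymm 0 hZ0 t ht0 htT
        rw [neg_zero] at this
        exact (Complex.conj_eq_iff_real.1 this.symm)
      rw [hK, Complex.ofReal_re] at hre
      have hK0 : 0 < K := hψ0.trans_le hre
      have hnorm : ‖kh 0 t‖ = K := by
        rw [hK, Complex.norm_real, Real.norm_eq_abs, abs_of_pos hK0]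
      have hMK : M ≤ δ * K := by
        rw [hMdef]
        gcongr
      have hg : ∀ n, ‖gSum p Z kh n t‖ ≤ 1 / 100 * M * K ^ (p + 1) := by
        intro n
        have := norm_gSum_le hp (hS Z) hK0 hM.le hδ0.le (by linarith) hMK hnorm.le hmodes n
        rwa [← hCdef, hCδ] at this
      intro q hq hfq
      by_cases h : q = 0
      · simp only [f', h, if_true]
        exact neg_re_zero_mode_deriv_neg hp hK hK0 hMK hδp (hg 0)
      simp only [f, h, if_false] at hfq
      have heq : ‖kh q t‖ = M * sqWeight q :=
        (sq_eq_sq₀ (norm_nonneg _) (mul_pos hM (sqWeight_pos q)).le).1 (sub_eq_zero.1 hfq)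
      by_cases hq2 : 2 ≤ |q|
      · simp only [f', h, if_false]
        exact inner_high_mode_deriv_neg hp hq2 hK hK0 hM heq (hg q)
      exfalso
      have hq1 : q = 1 ∨ q = -1 := by
        rw [not_le, abs_lt] at hq2
        omega
      have hneg1 : (-1 : ℤ) ∈ Z := by
        rcases hq1 with rfl | rfl
        · exact hZneg 1 hq
        · exact hq
      have hkq : ‖kh (-1) t‖ = M := by
        rcases hq1 with rfl | rfl
        · rw [hsymm 1 hq t ht0 htT, RCLike.norm_conj, heq]
          simp [sqWeight]
        · rw [heq]
          simp [sqWeight]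
      have hMS : M * S ≤ 1 / 100 * K := by
        have h1 : M * S ≤ δ * K * S := by gcongr
        have h2 : δ * S ≤ 1 / 100 := by nlinarith
        nlinarith
      have hle := norm_kh_neg_one_le hneg1
        (norm_kpoly_sub_le hZ0 (hS Z) hM.le hmodes) (by rw [hnorm]; linarith) (hclose t ht0 htT)
      rw [hkq, hnorm, le_div_iff₀ (by linarith)] at hle
      have hMS2 : M * S ^ 2 ≤ 1 / 100 * K := by
        have h1 : M * S ^ 2 ≤ δ * K * S ^ 2 := by gcongr
        nlinarith
      have hle' : K - M * S ≤ M * S ^ 2 :=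
        le_of_mul_le_mul_left (hle.trans_eq (by ring)) hM
      linarith
  intro q hq h
  rw [← hMdef, hweight q h, ← hsq]
  simpa only [f, h, if_false] using key T ⟨hT0, le_rfl⟩ q hq
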